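/- (Strict Efficiency Gain) If τ ≠ m on a set of positive probability (i.e., it is not the case that τ = m almost everywhere), then Var(ψ) < Var(A); that is, the one-step estimator's asymptotic variance is strictly smaller than that of the naive sample-mean estimator. -/

import Mathlib

open MeasureTheory ProbabilityTheory

/-- Conditional expectation is self-adjoint against square-integrable functions measurable
with respect to the sub-σ-algebra. -/
lemma integral_mul_condExp_of_stronglyMeasurable
    {Ω : Type*} {m mΩ : MeasurableSpace Ω} {P : Measure Ω} [IsFiniteMeasure P]
    (hm : m ≤ mΩ) {X A : Ω → ℝ} (hXm : StronglyMeasurable[m] X)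
    (hX : MemLp X 2 P) (hA : MemLp A 2 P) :
    ∫ ω, X ω * (P[A|m]) ω ∂P = ∫ ω, X ω * A ω ∂P := by
  have h := condExp_mul_of_stronglyMeasurable_left (μ := P) hXm (hX.integrable_mul hA)
    (hA.integrable one_le_two)
  have h' := integral_condExp (μ := P) (f := X * A) hm
  rw [integral_congr_ae h] at h'
  exact h'

/-- (Strict Efficiency Gain) If `τ ≠ m` on a set of positive probability, then
`Var(ψ) < Var(A)`: the one-step estimator's asymptotic variance is strictly smaller
than that of the naive sample-mean estimator. -/
theorem strict_efficiency_gain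
    {Ω : Type*} {mΩ : MeasurableSpace Ω} {P : Measure Ω} [IsProbabilityMeasure P]
    {G H : MeasurableSpace Ω} (hGH : G ≤ H) (hH : H ≤ mΩ)
    {A : Ω → ℝ} (hA : MemLp A 2 P)
    (hne : ¬ (P[A|H]) =ᵐ[P] (P[A|G])) :
    variance (fun ω => ((P[A|G]) ω - ∫ x, A x ∂P) + (A ω - (P[A|H]) ω)) P
      < variance A P := by
  have hT : MemLp (P[A|H]) 2 P := hA.condExp one_le_two
  have hM : MemLp (P[A|G]) 2 P := hA.condExp one_le_two
  have hTm : StronglyMeasurable[H] (P[A|H]) := stronglyMeasurable_condExp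
  have hMm : StronglyMeasurable[G] (P[A|G]) := stronglyMeasurable_condExp
  have iTT := integral_mul_condExp_of_stronglyMeasurable hH hTm hT hA
  have iMT := integral_mul_condExp_of_stronglyMeasurable hH (hMm.mono hGH) hM hA
  have iMM := integral_mul_condExp_of_stronglyMeasurable (hGH.trans hH) hMm hM hA
  have iT : ∫ ω, (P[A|H]) ω ∂P = ∫ ω, A ω ∂P := integral_condExp hH
  have iM : ∫ ω, (P[A|G]) ω ∂P = ∫ ω, A ω ∂P := integral_condExp (hGH.trans hH)
  set T := P[A|H]
  set M := P[A|G]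
  set θ := ∫ x, A x ∂P
  set D : Ω → ℝ := fun ω => T ω - M ω
  set ψ : Ω → ℝ := fun ω => (M ω - θ) + (A ω - T ω)
  have hD : MemLp D 2 P := hT.sub hM
  have hψ : MemLp ψ 2 P := (hM.sub (memLp_const θ)).add (hA.sub hT)
  have iD : ∫ ω, D ω ∂P = 0 := by
    rw [integral_sub (hT.integrable one_le_two) (hM.integrable one_le_two), iT, iM, sub_self]
  have iψD : ∫ ω, ψ ω * D ω ∂P = 0 := by
    have jMT := hM.integrable_mul hT
    have jMM := hM.integrable_mul hM
    have jTT := hT.integrable_mul hT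
    have jTA := hT.integrable_mul hA
    have jMA := hM.integrable_mul hA
    have jD := hD.integrable one_le_two
    have e : (fun ω => ψ ω * D ω) =
        (M * T - M * M) + (T * A - T * T) - (M * A - M * T) - θ • D := by
      funext ω
      simp only [ψ, D, Pi.mul_apply, Pi.add_apply, Pi.sub_apply, Pi.smul_apply, smul_eq_mul]
      ring
    rw [e, integral_sub' (((jMT.sub jMM).add (jTA.sub jTT)).sub (jMA.sub jMT)) (jD.smul θ),
      integral_sub' ((jMT.sub jMM).add (jTA.sub jTT)) (jMA.sub jMT),
      integral_add' (jMT.sub jMM) (jTA.sub jTT), integral_sub' jMT jMM, integral_sub' jTA jTT,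
      integral_sub' jMA jMT]
    simp only [Pi.smul_apply, integral_smul, iD, smul_zero]
    simp only [Pi.mul_apply, iTT, iMT, iMM]
    ring
  have hcov : cov[ψ, D; P] = 0 := by
    rw [covariance_eq_sub hψ hD, iD, mul_zero, sub_zero]
    exact iψD
  have hvar : Var[A; P] = Var[ψ; P] + Var[D; P] := by
    have e : A = fun ω => (ψ + D) ω + θ := by
      funext ω; simp only [ψ, D, Pi.add_apply]; ring
    rw [e, variance_add_const (hψ.add hD).aestronglyMeasurable, variance_add hψ hD, hcov]
    ring
  have hpos : 0 < Var[D; P] := by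
    refine (variance_nonneg D P).lt_of_ne' fun h0 => hne ?_
    rw [variance_of_integral_eq_zero hD.aemeasurable iD,
      integral_eq_zero_iff_of_nonneg (fun ω => sq_nonneg (D ω)) hD.integrable_sq] at h0
    filter_upwards [h0] with ω hω
    exact sub_eq_zero.mp (pow_eq_zero_iff two_ne_zero |>.mp hω)
  rw [hvar]
  exact lt_add_of_pos_right _ hpos
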